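/- arXiv:2211.05204 — 2 statements merged into one kernel-verified Lean document; each statement's English description precedes it below -/
import Mathlib

section
/- Let p be an odd prime and G a transitive abelian p-group. If G has minimal characteristic inertia, then G has minimal full inertia. -/
section Defs

variable {G : Type*} [AddCommGroup G]

/-- For a subgroup `X` of `G` and an endomorphism `φ` of `G`, `hatImage X φ` is the image
of `φ(X)` in the quotient `G ⧸ X`, i.e. the subgroup `(φ(X) + X)/X`. -/
def hatImage (X : AddSubgroup G) (φ : G →+ G) : AddSubgroup (G ⧸ X) :=
  (AddSubgroup.map φ X).map (QuotientAddGroup.mk' X)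

/-- `X` is fully invariant: stable under every additive endomorphism of `G`. -/
def FullyInvariantSub (X : AddSubgroup G) : Prop :=
  ∀ φ : G →+ G, AddSubgroup.map φ X ≤ X

/-- `X` is characteristic: stable under every additive automorphism of `G`. -/
def CharacteristicSub (X : AddSubgroup G) : Prop :=
  ∀ φ : G ≃+ G, AddSubgroup.map φ.toAddMonoidHom X ≤ X

/-- `X` is fully inert: `φ̂(X)` is finite for every endomorphism `φ` of `G`. -/
def FullyInertSub (X : AddSubgroup G) : Prop :=
  ∀ φ : G →+ G, Finite (hatImage X φ)

/-- `X` is characteristically inert: `φ̂(X)` is finite for every automorphism `φ` of `G`. -/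
def CharInertSub (X : AddSubgroup G) : Prop :=
  ∀ φ : G ≃+ G, Finite (hatImage X φ.toAddMonoidHom)

/-- Two subgroups are commensurable if their intersection has finite index in each of them. -/
def Commens (X Y : AddSubgroup G) : Prop :=
  ((X ⊓ Y).addSubgroupOf X).index ≠ 0 ∧ ((X ⊓ Y).addSubgroupOf Y).index ≠ 0

/-- `G` has minimal full inertia: every fully inert subgroup is commensurable with a
fully invariant subgroup. -/
def MinFullInertia (G : Type*) [AddCommGroup G] : Prop :=
  ∀ X : AddSubgroup G, FullyInertSub X → ∃ Y : AddSubgroup G, FullyInvariantSub Y ∧ Commens X Y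

/-- `G` has minimal characteristic inertia: every characteristically inert subgroup is
commensurable with a characteristic subgroup. -/
def MinCharInertia (G : Type*) [AddCommGroup G] : Prop :=
  ∀ X : AddSubgroup G, CharInertSub X → ∃ Y : AddSubgroup G, CharacteristicSub Y ∧ Commens X Y

/-- `G` is a `p`-group: every element is killed by some power of `p`. -/
def IsPGroup' (p : ℕ) (G : Type*) [AddCommGroup G] : Prop :=
  ∀ x : G, ∃ n : ℕ, p ^ n • x = 0

/-- Multiplication by `m` as an additive endomorphism of `G`. -/
def smulHom (m : ℕ) : G →+ G where
  toFun x := m • x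
  map_zero' := smul_zero m
  map_add' a b := smul_add m a b

/-- The subgroup `pⁿG`. -/
def pPowSub (p n : ℕ) : AddSubgroup G :=
  AddSubgroup.map (smulHom (p ^ n)) ⊤

/-- The subgroup `B[m] = {x ∈ B : m • x = 0}`. -/
def torSub (m : ℕ) (B : AddSubgroup G) : AddSubgroup G :=
  B ⊓ (smulHom m).ker

/-- The subgroup `mB = {m • x : x ∈ B}`. -/
def smulSub (m : ℕ) (B : AddSubgroup G) : AddSubgroup G :=
  AddSubgroup.map (smulHom m) B

/-- The `p`-height of `x` in `G`: the supremum in `ℕ∞` of the set of `n` with `x ∈ pⁿG`. -/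
noncomputable def pHeight (p : ℕ) (x : G) : ℕ∞ :=
  ⨆ n ∈ {n : ℕ | x ∈ (pPowSub p n : AddSubgroup G)}, (n : ℕ∞)

/-- `G` is transitive: any two elements with identical height sequences are connected by
an automorphism. -/
def TransitiveP (p : ℕ) (G : Type*) [AddCommGroup G] : Prop :=
  ∀ x y : G, (∀ n : ℕ, pHeight p (p ^ n • x) = pHeight p (p ^ n • y)) →
    ∃ φ : G ≃+ G, φ x = y

/-- `G` is separable: `p^ω G = ⋂ₙ pⁿG = 0`. -/
def SeparableP (p : ℕ) (G : Type*) [AddCommGroup G] : Prop :=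
  (⨅ n : ℕ, (pPowSub p n : AddSubgroup G)) = ⊥

end Defs

section Helpers

variable {G : Type*} [AddCommGroup G]

theorem mem_pPow {p n : ℕ} {x : G} :
    x ∈ (pPowSub p n : AddSubgroup G) ↔ ∃ g : G, p ^ n • g = x := by
  constructor
  · rintro ⟨g, -, rfl⟩
    exact ⟨g, rfl⟩
  · rintro ⟨g, rfl⟩
    exact ⟨g, trivial, rfl⟩

theorem pPow_anti {p m n : ℕ} (h : m ≤ n) {x : G}
    (hx : x ∈ (pPowSub p n : AddSubgroup G)) : x ∈ (pPowSub p m : AddSubgroup G) := by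
  obtain ⟨g, rfl⟩ := mem_pPow.1 hx
  refine mem_pPow.2 ⟨p ^ (n - m) • g, ?_⟩
  rw [← mul_smul, ← pow_add, Nat.add_sub_cancel' h]

theorem pPow_smul {p n : ℕ} (k : ℕ) {x : G}
    (hx : x ∈ (pPowSub p n : AddSubgroup G)) :
    p ^ k • x ∈ (pPowSub p (n + k) : AddSubgroup G) := by
  obtain ⟨g, rfl⟩ := mem_pPow.1 hx
  refine mem_pPow.2 ⟨g, ?_⟩
  rw [← mul_smul, ← pow_add, add_comm]

theorem pPow_map {p n : ℕ} (φ : G →+ G) {x : G}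
    (hx : x ∈ (pPowSub p n : AddSubgroup G)) : φ x ∈ (pPowSub p n : AddSubgroup G) := by
  obtain ⟨g, rfl⟩ := mem_pPow.1 hx
  exact mem_pPow.2 ⟨φ g, by simp⟩

theorem two_not_mem {p : ℕ} (hp : p.Prime) (hodd : p ≠ 2) (n : ℕ) {e : G}
    (he : p • e = 0) (h : e + e ∈ (pPowSub p n : AddSubgroup G)) :
    e ∈ (pPowSub p n : AddSubgroup G) := by
  obtain ⟨k, hk⟩ := hp.odd_of_ne_two hodd
  have h1 : e = -(k • (e + e)) := by
    have : p • e = k • (e + e) + e := by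
      rw [hk, add_smul, one_smul, mul_comm, mul_smul, two_smul]
    rw [he] at this
    exact (neg_eq_of_add_eq_zero_right this.symm).symm
  rw [h1]
  exact neg_mem (nsmul_mem h k)

theorem sep_of_trans {p : ℕ} (htrans : TransitiveP p G) {x : G}
    (hx : ∀ m, x ∈ (pPowSub p m : AddSubgroup G)) : x = 0 := by
  obtain ⟨φ, hφ⟩ := htrans 0 x (by
    intro n
    unfold pHeight
    congr 1
    funext m
    have h1 : p ^ n • (0 : G) ∈ (pPowSub p m : AddSubgroup G) := by
      rw [smul_zero]; exact zero_mem _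
    have h2 : p ^ n • x ∈ (pPowSub p m : AddSubgroup G) := nsmul_mem (hx m) _
    simp only [Set.mem_ofPred_eq, h1, h2])
  rw [← hφ, map_zero]

/-- heights of multiples of `z` dominate those of `x` -/
def Dom (p : ℕ) (x z : G) : Prop :=
  ∀ n m, p ^ n • x ∈ (pPowSub p m : AddSubgroup G) → p ^ n • z ∈ (pPowSub p m : AddSubgroup G)

/-- exactness at `n` -/
def Exa (p : ℕ) (x z : G) (n : ℕ) : Prop :=
  ∀ m, p ^ n • z ∈ (pPowSub p m : AddSubgroup G) → p ^ n • x ∈ (pPowSub p m : AddSubgroup G)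

theorem exa_step {p : ℕ} {x z : G} {N h : ℕ}
    (hh : p ^ N • x ∈ (pPowSub p h : AddSubgroup G))
    (hz : p ^ N • z ∉ (pPowSub p (h + 1) : AddSubgroup G)) : Exa p x z N := by
  intro m hm
  by_cases hmh : m ≤ h
  · exact pPow_anti hmh hh
  · exact absurd (pPow_anti (by omega) hm) hz

theorem pigeon {H : AddSubgroup G} {a b e : G} (h1 : e ∉ H) (h2 : e + e ∉ H)
    (c0 : ¬(a ∉ H ∧ b ∉ H)) (c1 : ¬(a + e ∉ H ∧ b - e ∉ H)) (c2 : ¬(a - e ∉ H ∧ b + e ∉ H)) :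
    False := by
  have A1 : ∀ u : G, u ∈ H → u + e ∉ H := fun u q r => h1 (by simpa using sub_mem r q)
  have A2 : ∀ u : G, u ∈ H → u - e ∉ H := fun u q r => h1 (by simpa using sub_mem q r)
  have A3 : ∀ u : G, u + e ∈ H → u - e ∉ H := fun u q r => h2 (by
    have := sub_mem q r; rwa [add_sub_sub_cancel] at this)
  by_cases ha : a ∈ H
  · have h3 : b - e ∈ H := by
      by_contra hc; exact c1 ⟨A1 a ha, hc⟩
    have h4 : b + e ∈ H := by
      by_contra hc; exact c2 ⟨A2 a ha, hc⟩
    exact A3 b h4 h3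
  · have hb : b ∈ H := by
      by_contra hc; exact c0 ⟨ha, hc⟩
    have h3 : a + e ∈ H := by
      by_contra hc; exact c1 ⟨hc, A2 b hb⟩
    have h4 : a - e ∈ H := by
      by_contra hc; exact c2 ⟨hc, A1 b hb⟩
    exact A3 a h3 h4

theorem exists_split {p : ℕ} (hp : p.Prime) (hodd : p ≠ 2) (htrans : TransitiveP p G)
    {x y : G} (hy : Dom p x y) {k : ℕ} (hk : p ^ k • x = 0) (j : ℕ) :
    ∃ z, Dom p x z ∧ ∀ n, k ≤ n + j → Exa p x z n ∧ Exa p x (y - z) n := by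
  induction j with
  | zero =>
    refine ⟨0, ?_, ?_⟩
    · intro n m _
      rw [smul_zero]; exact zero_mem _
    · intro n hn
      have : p ^ n • x = 0 := by
        obtain ⟨d, rfl⟩ := Nat.exists_eq_add_of_le (show k ≤ n by omega)
        rw [pow_add, mul_comm, mul_smul, hk, smul_zero]
      constructor <;> (intro m _; rw [this]; exact zero_mem _)
  | succ j ih =>
    obtain ⟨z, hz, hE⟩ := ih
    by_cases hjk : k ≤ j
    · exact ⟨z, hz, fun n _ => hE n (by omega)⟩
    obtain ⟨N, hN⟩ : ∃ N, k = N + (j + 1) := ⟨k - (j + 1), by omega⟩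
    suffices H : ∃ w, Dom p x w ∧ p ^ (N + 1) • w = 0 ∧
        Exa p x (z + w) N ∧ Exa p x (y - (z + w)) N by
      obtain ⟨w, hw, hw0, h1, h2⟩ := H
      refine ⟨z + w, ?_, ?_⟩
      · intro n m hm
        rw [smul_add]
        exact add_mem (hz n m hm) (hw n m hm)
      · intro n hn
        by_cases hnN : n = N
        · subst hnN; exact ⟨h1, h2⟩
        · have h0 : p ^ n • w = 0 := by
            obtain ⟨d, rfl⟩ := Nat.exists_eq_add_of_le (show N + 1 ≤ n by omega)
            rw [pow_add, mul_comm, mul_smul, hw0, smul_zero]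
          obtain ⟨h3, h4⟩ := hE n (by omega)
          unfold Exa at *
          simp only [smul_add, smul_sub, h0, add_zero] at *
          exact ⟨h3, h4⟩
    have hd0 : Dom p x 0 := by
      intro n m _
      rw [smul_zero]; exact zero_mem _
    by_cases hx0 : p ^ N • x = 0
    · exact ⟨0, hd0, smul_zero _, fun m _ => by rw [hx0]; exact zero_mem _,
        fun m _ => by rw [hx0]; exact zero_mem _⟩
    obtain ⟨h, hh, hh'⟩ : ∃ h, p ^ N • x ∈ (pPowSub p h : AddSubgroup G) ∧
        p ^ N • x ∉ (pPowSub p (h + 1) : AddSubgroup G) := by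
      by_contra hcon
      push Not at hcon
      apply hx0
      apply sep_of_trans htrans
      intro m
      induction m with
      | zero => exact mem_pPow.2 ⟨p ^ N • x, by simp⟩
      | succ m ihm => exact hcon m ihm
    by_cases hgap : p ^ (N + 1) • x ∈ (pPowSub p (h + 2) : AddSubgroup G)
    · -- gap
      obtain ⟨g, hg⟩ := mem_pPow.1 hgap
      obtain ⟨e, he⟩ : ∃ e, e = p ^ N • x - p ^ (h + 1) • g := ⟨_, rfl⟩
      have hpe : p • e = 0 := by
        rw [he, smul_sub, ← mul_smul, ← mul_smul, ← pow_succ', ← pow_succ', hg, sub_self]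
      have hgm : p ^ (h + 1) • g ∈ (pPowSub p (h + 1) : AddSubgroup G) := mem_pPow.2 ⟨g, rfl⟩
      have heh : e ∈ (pPowSub p h : AddSubgroup G) := by
        rw [he]; exact sub_mem hh (pPow_anti (by omega) hgm)
      have heh' : e ∉ (pPowSub p (h + 1) : AddSubgroup G) := by
        intro hc
        apply hh'
        have := add_mem hc hgm
        rwa [he, sub_add_cancel] at this
      have hle : ∀ i m, i ≤ N → p ^ i • x ∈ (pPowSub p m : AddSubgroup G) → m + (N - i) ≤ h := by
        intro i m hi hm
        have h1 := pPow_smul (N - i) hm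
        rw [← mul_smul, ← pow_add, Nat.sub_add_cancel hi] at h1
        by_contra hc
        exact hh' (pPow_anti (by omega) h1)
      have hNh : N ≤ h := by
        have := hle 0 0 (by omega) (mem_pPow.2 ⟨p ^ 0 • x, by simp⟩)
        omega
      obtain ⟨d, hd⟩ := mem_pPow.1 heh
      obtain ⟨w, hw⟩ : ∃ w, w = p ^ (h - N) • d := ⟨_, rfl⟩
      have hwN : p ^ N • w = e := by
        rw [hw, ← mul_smul, ← pow_add, Nat.add_sub_cancel' hNh, hd]
      have hw0 : p ^ (N + 1) • w = 0 := by
        rw [pow_succ', mul_smul, hwN, hpe]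
      have hdw : Dom p x w := by
        intro i m hm
        by_cases hi : i ≤ N
        · have := hle i m hi hm
          have h2 : w ∈ (pPowSub p (h - N) : AddSubgroup G) := mem_pPow.2 ⟨d, hw.symm⟩
          exact pPow_anti (by omega) (pPow_smul i h2)
        · obtain ⟨c, rfl⟩ := Nat.exists_eq_add_of_le (show N + 1 ≤ i by omega)
          rw [pow_add, mul_comm, mul_smul, hw0, smul_zero]
          exact zero_mem _
      have h2e : e + e ∉ (pPowSub p (h + 1) : AddSubgroup G) :=
        fun hc => heh' (two_not_mem hp hodd _ hpe hc)
      by_cases c0 : p ^ N • z ∉ (pPowSub p (h + 1) : AddSubgroup G) ∧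
          p ^ N • (y - z) ∉ (pPowSub p (h + 1) : AddSubgroup G)
      · exact ⟨0, hd0, smul_zero _, exa_step hh (by simpa using c0.1),
          exa_step hh (by simpa using c0.2)⟩
      by_cases c1 : p ^ N • z + e ∉ (pPowSub p (h + 1) : AddSubgroup G) ∧
          p ^ N • (y - z) - e ∉ (pPowSub p (h + 1) : AddSubgroup G)
      · refine ⟨w, hdw, hw0, exa_step hh ?_, exa_step hh ?_⟩
        · rw [smul_add, hwN]; exact c1.1
        · rw [← sub_sub, smul_sub, hwN]; exact c1.2
      by_cases c2 : p ^ N • z - e ∉ (pPowSub p (h + 1) : AddSubgroup G) ∧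
          p ^ N • (y - z) + e ∉ (pPowSub p (h + 1) : AddSubgroup G)
      · refine ⟨-w, ?_, by rw [smul_neg, hw0, neg_zero], exa_step hh ?_, exa_step hh ?_⟩
        · intro n m hm
          rw [smul_neg]; exact neg_mem (hdw n m hm)
        · rw [smul_add, smul_neg, hwN, ← sub_eq_add_neg]; exact c2.1
        · rw [← sub_sub, sub_neg_eq_add, smul_add, hwN]; exact c2.2
      exfalso
      exact pigeon heh' h2e c0 c1 c2
    · -- no gap
      have hng : ∀ u : G, Exa p x u (N + 1) → Exa p x u N := by
        intro u hu
        apply exa_step hh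
        intro hc
        apply hgap
        apply hu
        have := pPow_smul 1 hc
        rwa [← mul_smul, ← pow_add, add_comm 1 N] at this
      obtain ⟨h3, h4⟩ := hE (N + 1) (by omega)
      exact ⟨0, hd0, smul_zero _, by simpa using hng _ h3, by simpa using hng _ h4⟩

theorem char_fully {p : ℕ} (hp : p.Prime) (hodd : p ≠ 2) (hG : IsPGroup' p G)
    (htrans : TransitiveP p G) {Y : AddSubgroup G} (hY : CharacteristicSub Y) :
    FullyInvariantSub Y := by
  rintro φ _ ⟨x, hx, rfl⟩
  have hdy : Dom p x (φ x) := by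
    intro n m hm
    rw [← map_nsmul]
    exact pPow_map φ hm
  obtain ⟨k, hk⟩ := hG x
  obtain ⟨z, hz, hE⟩ := exists_split hp hodd htrans hdy hk k
  have main : ∀ u, Dom p x u → (∀ n, Exa p x u n) → u ∈ Y := by
    intro u hu hu'
    obtain ⟨ψ, hψ⟩ := htrans x u (by
      intro n
      unfold pHeight
      congr 1
      funext m
      have : p ^ n • x ∈ (pPowSub p m : AddSubgroup G) ↔
        p ^ n • u ∈ (pPowSub p m : AddSubgroup G) := ⟨hu n m, hu' n m⟩
      simp only [Set.mem_ofPred_eq, this])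
    rw [← hψ]
    exact hY ψ ⟨x, hx, rfl⟩
  have h1 := main z hz (fun n => (hE n (by omega)).1)
  have h2 := main (φ x - z) (fun n m hm => by
    rw [smul_sub]; exact sub_mem (hdy n m hm) (hz n m hm)) (fun n => (hE n (by omega)).2)
  simpa using add_mem h1 h2

end Helpers

/-- Corollary 2.9: for an odd prime `p` and a transitive `p`-group `G`, minimal characteristic
inertia implies minimal full inertia. -/
theorem stmt_8 {G : Type*} [AddCommGroup G] (p : ℕ) (hp : p.Prime) (hodd : p ≠ 2)
    (hG : IsPGroup' p G) (htrans : TransitiveP p G)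
    (hmin : MinCharInertia G) :
    MinFullInertia G := by
  intro X hX
  obtain ⟨Y, hY, hc⟩ := hmin X (fun φ => hX φ.toAddMonoidHom)
  exact ⟨Y, char_fully hp hodd hG htrans hY, hc⟩
end

section
/- Let p be a prime and A an abelian p-group. Then A has minimal full inertia but does not have minimal characteristic inertia if, and only if, the square G = A ⊕ A has minimal characteristic inertia but A itself does not have minimal characteristic inertia. -/
/-- `Y` is almost contained in `X`. -/
def AL {G : Type*} [AddCommGroup G] (Y X : AddSubgroup G) : Prop :=
  ∃ F : Set G, F.Finite ∧ ∀ y ∈ Y, ∃ f ∈ F, y - f ∈ X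

section helpers

variable {G H : Type*} [AddCommGroup G] [AddCommGroup H]

theorem AL.of_le {Y X : AddSubgroup G} (h : Y ≤ X) : AL Y X :=
  ⟨{0}, Set.finite_singleton 0, fun y hy => ⟨0, rfl, by simpa using h hy⟩⟩

theorem AL.trans {Z Y X : AddSubgroup G} (h : AL Z Y) (k : AL Y X) : AL Z X := by
  obtain ⟨F, hF, h⟩ := h
  obtain ⟨E, hE, k⟩ := k
  refine ⟨Set.image2 (fun a b => a + b) F E, hF.image2 _ hE, fun z hz => ?_⟩
  obtain ⟨f, hf, h1⟩ := h z hz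
  obtain ⟨e, he, h2⟩ := k _ h1
  exact ⟨f + e, ⟨f, hf, e, he, rfl⟩, by rwa [← sub_sub]⟩

theorem AL.map {Y X : AddSubgroup G} (φ : G →+ H) (h : AL Y X) : AL (Y.map φ) (X.map φ) := by
  obtain ⟨F, hF, h⟩ := h
  refine ⟨φ '' F, hF.image _, ?_⟩
  rintro _ ⟨y, hy, rfl⟩
  obtain ⟨f, hf, h1⟩ := h y hy
  exact ⟨φ f, ⟨f, hf, rfl⟩, _, h1, by simp⟩

theorem AL.sup {Y Z X : AddSubgroup G} (h : AL Y X) (k : AL Z X) : AL (Y ⊔ Z) X := by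
  obtain ⟨F, hF, h⟩ := h
  obtain ⟨E, hE, k⟩ := k
  refine ⟨Set.image2 (fun a b => a + b) F E, hF.image2 _ hE, fun w hw => ?_⟩
  obtain ⟨y, hy, z, hz, rfl⟩ := AddSubgroup.mem_sup.1 hw
  obtain ⟨f, hf, h1⟩ := h y hy
  obtain ⟨e, he, h2⟩ := k z hz
  refine ⟨f + e, ⟨f, hf, e, he, rfl⟩, ?_⟩
  rw [add_sub_add_comm]
  exact X.add_mem h1 h2

theorem AL.prod {Y X : AddSubgroup G} {Y' X' : AddSubgroup H} (h : AL Y X) (k : AL Y' X') :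
    AL (Y.prod Y') (X.prod X') := by
  obtain ⟨F, hF, h⟩ := h
  obtain ⟨E, hE, k⟩ := k
  refine ⟨F ×ˢ E, hF.prod hE, ?_⟩
  rintro ⟨y, z⟩ ⟨hy, hz⟩
  obtain ⟨f, hf, h1⟩ := h y hy
  obtain ⟨e, he, h2⟩ := k z hz
  exact ⟨(f, e), ⟨hf, he⟩, h1, h2⟩

theorem finite_hat_iff (X : AddSubgroup G) (φ : G →+ G) :
    Finite (hatImage X φ) ↔ AL (X.map φ) X := by
  constructor
  · intro h
    have hf : ((hatImage X φ : AddSubgroup (G ⧸ X)) : Set (G ⧸ X)).Finite := Set.toFinite _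
    refine ⟨Quotient.out '' ((hatImage X φ : AddSubgroup (G ⧸ X)) : Set (G ⧸ X)),
      hf.image _, fun y hy => ?_⟩
    refine ⟨_, ⟨(y : G ⧸ X), ⟨y, hy, rfl⟩, rfl⟩, ?_⟩
    rw [← QuotientAddGroup.eq_iff_sub_mem]
    exact (Quotient.out_eq _).symm
  · rintro ⟨F, hF, h⟩
    refine Set.Finite.subset (hF.image (QuotientAddGroup.mk' X)) ?_
    rintro _ ⟨y, hy, rfl⟩
    obtain ⟨f, hf, h1⟩ := h y hy
    exact ⟨f, hf, (QuotientAddGroup.eq_iff_sub_mem.2 h1).symm⟩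

theorem index_iff (X Y : AddSubgroup G) (K : AddSubgroup G) (hK : ∀ y ∈ Y, y ∈ K ↔ y ∈ X) :
    (K.addSubgroupOf Y).index ≠ 0 ↔ AL Y X := by
  constructor
  · intro h
    have : (K.addSubgroupOf Y).FiniteIndex := ⟨h⟩
    have : Finite (Y ⧸ K.addSubgroupOf Y) := inferInstance
    refine ⟨Set.range fun q : Y ⧸ K.addSubgroupOf Y => (q.out : G), Set.finite_range _,
      fun y hy => ⟨_, ⟨((⟨y, hy⟩ : Y) : Y ⧸ K.addSubgroupOf Y), rfl⟩, ?_⟩⟩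
    have h1 : ((⟨y, hy⟩ : Y) : Y ⧸ K.addSubgroupOf Y) =
      ((((⟨y, hy⟩ : Y) : Y ⧸ K.addSubgroupOf Y).out : Y) : Y ⧸ K.addSubgroupOf Y) :=
      (Quotient.out_eq _).symm
    rw [QuotientAddGroup.eq_iff_sub_mem, AddSubgroup.mem_addSubgroupOf] at h1
    exact (hK _ (Subtype.property _)).1 h1
  · rintro ⟨F, hF, h⟩
    choose! c hc hc' using h
    have := hF.to_subtype
    have : Finite (Y ⧸ K.addSubgroupOf Y) := by
      refine Finite.of_injective
        (fun q : Y ⧸ K.addSubgroupOf Y => (⟨c (q.out : G), hc _ q.out.2⟩ : F)) ?_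
      intro q r hqr
      have h1 : c (q.out : G) = c (r.out : G) := congrArg Subtype.val hqr
      rw [← Quotient.out_eq q, ← Quotient.out_eq r]
      refine QuotientAddGroup.eq_iff_sub_mem.2 ?_
      rw [AddSubgroup.mem_addSubgroupOf]
      refine (hK _ (Subtype.property _)).2 ?_
      have h2 := X.sub_mem (hc' _ q.out.2) (hc' _ r.out.2)
      rw [h1, sub_sub_sub_cancel_right] at h2
      exact h2
    exact AddSubgroup.index_ne_zero_of_finite

theorem commens_iff (X Y : AddSubgroup G) : Commens X Y ↔ AL X Y ∧ AL Y X := by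
  unfold Commens
  rw [index_iff Y X (X ⊓ Y) (fun y hy => ⟨fun h => h.2, fun h => ⟨hy, h⟩⟩),
    index_iff X Y (X ⊓ Y) (fun y hy => ⟨fun h => h.1, fun h => ⟨h, hy⟩⟩)]

/-- The automorphism `(x, y) ↦ (x + b y, y)`. -/
def shear (b : G →+ G) : (G × G) ≃+ (G × G) where
  toFun x := (x.1 + b x.2, x.2)
  invFun x := (x.1 - b x.2, x.2)
  left_inv x := by simp
  right_inv x := by simp
  map_add' x y := by
    ext
    · simp; abel
    · simp

/-- Every endomorphism of the square is an alternating sum of automorphisms. -/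
theorem endo_induction (P : (G × G →+ G × G) → Prop)
    (haut : ∀ φ : (G × G) ≃+ (G × G), P φ.toAddMonoidHom)
    (hadd : ∀ φ ψ, P φ → P ψ → P (φ + ψ)) (hsub : ∀ φ ψ, P φ → P ψ → P (φ - ψ))
    (φ : G × G →+ G × G) : P φ := by
  let S : (G × G) ≃+ (G × G) := AddEquiv.prodComm
  let E (b : G →+ G) (u v : (G × G) ≃+ (G × G)) : G × G →+ G × G :=
    ((u.trans (shear b)).trans v).toAddMonoidHom - (u.trans v).toAddMonoidHom
  have hE : ∀ b u v, P (E b u v) := fun b u v => hsub _ _ (haut _) (haut _)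
  let a := (AddMonoidHom.fst G G).comp (φ.comp (AddMonoidHom.inl G G))
  let b := (AddMonoidHom.fst G G).comp (φ.comp (AddMonoidHom.inr G G))
  let c := (AddMonoidHom.snd G G).comp (φ.comp (AddMonoidHom.inl G G))
  let d := (AddMonoidHom.snd G G).comp (φ.comp (AddMonoidHom.inr G G))
  have key : φ = (E a S (AddEquiv.refl _) + E b (AddEquiv.refl _) (AddEquiv.refl _)) +
      (E c S S + E d (AddEquiv.refl _) S) := by
    refine AddMonoidHom.ext fun x => ?_
    have hx : φ x = φ (x.1, 0) + φ (0, x.2) := by rw [← map_add]; simp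
    rw [hx]
    ext <;> simp [E, S, shear, a, b, c, d]
  rw [key]
  exact hadd _ _ (hadd _ _ (hE _ _ _) (hE _ _ _)) (hadd _ _ (hE _ _ _) (hE _ _ _))

theorem AL.map_add {X : AddSubgroup G} {φ ψ : G →+ G} (h : AL (X.map φ) X) (k : AL (X.map ψ) X) :
    AL (X.map (φ + ψ)) X := by
  refine AL.trans (AL.of_le ?_) (h.sup k)
  rintro _ ⟨x, hx, rfl⟩
  exact AddSubgroup.add_mem_sup ⟨x, hx, rfl⟩ ⟨x, hx, rfl⟩

theorem AL.map_sub {X : AddSubgroup G} {φ ψ : G →+ G} (h : AL (X.map φ) X) (k : AL (X.map ψ) X) :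
    AL (X.map (φ - ψ)) X := by
  refine AL.trans (AL.of_le ?_) (h.sup k)
  rintro _ ⟨x, hx, rfl⟩
  exact sub_mem (AddSubgroup.mem_sup_left ⟨x, hx, rfl⟩) (AddSubgroup.mem_sup_right ⟨x, hx, rfl⟩)

theorem charSquare_of_full (h : MinFullInertia G) : MinCharInertia (G × G) := by
  intro X hX
  have hall : ∀ φ : G × G →+ G × G, AL (X.map φ) X :=
    endo_induction _ (fun φ => (finite_hat_iff _ _).1 (hX φ))
      (fun _ _ => AL.map_add) (fun _ _ => AL.map_sub)
  let π := AddMonoidHom.fst G G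
  let π' := AddMonoidHom.snd G G
  let ι := AddMonoidHom.inl G G
  let ι' := AddMonoidHom.inr G G
  obtain ⟨Z, hZ, hc⟩ := h (X.map π) (fun ψ => by
    rw [finite_hat_iff]
    refine AL.trans (AL.of_le ?_) ((hall (ι.comp (ψ.comp π))).map π)
    rintro _ ⟨_, ⟨x, hx, rfl⟩, rfl⟩
    exact ⟨_, ⟨x, hx, rfl⟩, rfl⟩)
  obtain ⟨h1, h2⟩ := (commens_iff _ _).1 hc
  refine ⟨Z.prod Z, ?_, (commens_iff _ _).2 ⟨?_, ?_⟩⟩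
  · rintro φ _ ⟨⟨x, y⟩, ⟨hx, hy⟩, rfl⟩
    have e : φ.toAddMonoidHom (x, y) = φ.toAddMonoidHom (ι x) + φ.toAddMonoidHom (ι' y) := by
      rw [← map_add]; simp [ι, ι']
    rw [e]
    exact ⟨Z.add_mem (hZ (π.comp (φ.toAddMonoidHom.comp ι)) ⟨x, hx, rfl⟩)
        (hZ (π.comp (φ.toAddMonoidHom.comp ι')) ⟨y, hy, rfl⟩),
      Z.add_mem (hZ (π'.comp (φ.toAddMonoidHom.comp ι)) ⟨x, hx, rfl⟩)
        (hZ (π'.comp (φ.toAddMonoidHom.comp ι')) ⟨y, hy, rfl⟩)⟩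
  · have h3 : AL (X.map π') (X.map π) := by
      refine AL.trans (AL.of_le ?_) ((hall (ι.comp π')).map π)
      rintro _ ⟨x, hx, rfl⟩
      exact ⟨_, ⟨x, hx, rfl⟩, rfl⟩
    refine AL.trans (AL.of_le ?_) (h1.prod (h3.trans h1))
    intro x hx
    exact ⟨⟨x, hx, rfl⟩, ⟨x, hx, rfl⟩⟩
  · refine (h2.prod h2).trans (AL.trans (AL.of_le ?_) ((hall (ι.comp π)).sup (hall (ι'.comp π))))
    rintro ⟨_, _⟩ ⟨⟨x, hx, rfl⟩, ⟨y, hy, rfl⟩⟩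
    have e : (π x, π y) = (ι.comp π) x + (ι'.comp π) y := by simp [ι, ι']
    change (π x, π y) ∈ _
    rw [e]
    exact AddSubgroup.add_mem_sup ⟨x, hx, rfl⟩ ⟨y, hy, rfl⟩

theorem full_of_charSquare (h : MinCharInertia (G × G)) : MinFullInertia G := by
  intro X hX
  have hall : ∀ φ : G →+ G, AL (X.map φ) X := fun φ => (finite_hat_iff _ _).1 (hX φ)
  let π := AddMonoidHom.fst G G
  let π' := AddMonoidHom.snd G G
  let ι := AddMonoidHom.inl G G
  let ι' := AddMonoidHom.inr G G
  obtain ⟨W, hW, hc⟩ := h (X.prod X) (fun φ => by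
    rw [finite_hat_iff]
    let f := φ.toAddMonoidHom
    refine AL.trans (AL.of_le ?_) (((hall (π.comp (f.comp ι))).sup (hall (π.comp (f.comp ι')))).prod
      ((hall (π'.comp (f.comp ι))).sup (hall (π'.comp (f.comp ι')))))
    rintro _ ⟨⟨x, y⟩, ⟨hx, hy⟩, rfl⟩
    have e : φ.toAddMonoidHom (x, y) = f (ι x) + f (ι' y) := by
      rw [← map_add]; simp [ι, ι', f]
    rw [e]
    exact ⟨AddSubgroup.add_mem_sup ⟨x, hx, rfl⟩ ⟨y, hy, rfl⟩,
      AddSubgroup.add_mem_sup ⟨x, hx, rfl⟩ ⟨y, hy, rfl⟩⟩)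
  obtain ⟨h1, h2⟩ := (commens_iff _ _).1 hc
  have hWall : ∀ φ : G × G →+ G × G, ∀ w ∈ W, φ w ∈ W :=
    endo_induction _ (fun φ w hw => hW φ ⟨w, hw, rfl⟩)
      (fun _ _ h k w hw => W.add_mem (h w hw) (k w hw))
      (fun _ _ h k w hw => W.sub_mem (h w hw) (k w hw))
  have hXm : (X.prod X).map π = X := by
    ext x
    constructor
    · rintro ⟨y, hy, rfl⟩
      exact hy.1
    · intro hx
      exact ⟨(x, 0), ⟨hx, X.zero_mem⟩, rfl⟩
  refine ⟨W.map π, ?_, (commens_iff _ _).2 ⟨?_, ?_⟩⟩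
  · rintro φ _ ⟨_, ⟨w, hw, rfl⟩, rfl⟩
    exact ⟨_, hWall (ι.comp (φ.comp π)) w hw, rfl⟩
  · simpa only [hXm] using h1.map π
  · simpa only [hXm] using h2.map π

end helpers


/-- Corollary 2.11: `A` has minimal full inertia but not minimal characteristic inertia iff
`A ⊕ A` has minimal characteristic inertia while `A` does not. -/
theorem stmt_10 {A : Type*} [AddCommGroup A] (p : ℕ) (hp : p.Prime) (hA : IsPGroup' p A) :
    (MinFullInertia A ∧ ¬ MinCharInertia A) ↔
      (MinCharInertia (A × A) ∧ ¬ MinCharInertia A) := by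
  exact and_congr_left fun _ => ⟨charSquare_of_full, full_of_charSquare⟩
end
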